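/- Let 𝒳 be a set and σ : 𝒳 → 𝒳 a confined self-map. Assume Λ is finite with Λ > 1 and that the Cesàro mean B := 𝒞(σ_k/Λ^k) exists and is strictly positive. Let g : 𝒩 → ℝ be a strongly additive function satisfying Condition (*) with limit probability measure ρ. Then for every ε > 0, limsup_{C→∞} limsup_{X→∞} (1/(B log X)) · log ℙ_X[ | Σ_{P ∈ 𝒫(X), |g(P)| > C, P ∣ O} g(P) | ≥ ε B log X ] = −∞. -/

import Mathlib

open Filter Topology Real MeasureTheory Asymptotics
open scoped Classical

noncomputable section

/-- `σ` is confined: every iterate has only finitely many fixed points. -/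
def Confined {𝒳 : Type*} (σ : 𝒳 → 𝒳) : Prop :=
  ∀ k : ℕ, 1 ≤ k → {x : 𝒳 | σ^[k] x = x}.Finite

/-- `σ_k`: the number of fixed points of the `k`-th iterate of `σ`. -/
def fixCount {𝒳 : Type*} (σ : 𝒳 → 𝒳) (k : ℕ) : ℕ :=
  Nat.card {x : 𝒳 // σ^[k] x = x}

/-- A prime orbit: a finite set of the form `{x, σ x, …, σ^[ℓ-1] x}` of cardinality
exactly `ℓ ≥ 1`, mapped to itself by `σ`. -/
def IsPrimeOrbit {𝒳 : Type*} (σ : 𝒳 → 𝒳) (P : Set 𝒳) : Prop :=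
  ∃ (x : 𝒳) (ℓ : ℕ), 0 < ℓ ∧ P = (fun i => σ^[i] x) '' Set.Iio ℓ ∧ P.ncard = ℓ ∧ σ '' P = P

/-- The type of prime orbits of `σ`. -/
def PrimeOrbit {𝒳 : Type*} (σ : 𝒳 → 𝒳) := {P : Set 𝒳 // IsPrimeOrbit σ P}

/-- The length `ℓ(P)` of a prime orbit. -/
def orbitLen {𝒳 : Type*} {σ : 𝒳 → 𝒳} (P : PrimeOrbit σ) : ℕ := P.1.ncard

/-- General orbits: elements of the free abelian monoid on the prime orbits,
i.e. finitely supported multisets of prime orbits. -/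
abbrev GenOrbit {𝒳 : Type*} (σ : 𝒳 → 𝒳) := PrimeOrbit σ →₀ ℕ

/-- The length of a general orbit: sum of the lengths of its prime components,
with multiplicity. -/
def genLen {𝒳 : Type*} {σ : 𝒳 → 𝒳} (O : GenOrbit σ) : ℕ :=
  O.sum fun P m => m * orbitLen P

/-- `N_σ(X)`: the number of general orbits of length at most `X`. -/
def Ncount {𝒳 : Type*} (σ : 𝒳 → 𝒳) (X : ℕ) : ℕ :=
  Nat.card {O : GenOrbit σ // genLen O ≤ X}

/-- `P_ℓ`: the number of prime orbits of length `ℓ`. -/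
def Pcount {𝒳 : Type*} (σ : 𝒳 → 𝒳) (ℓ : ℕ) : ℕ :=
  Nat.card {P : PrimeOrbit σ // orbitLen P = ℓ}

/-- The Mertens-type counting function `M_σ(X) = Σ_{1 ≤ ℓ ≤ X} P_ℓ Λ^{-ℓ}`. -/
def Mfun {𝒳 : Type*} (σ : 𝒳 → 𝒳) (Λ : ℝ) (X : ℕ) : ℝ :=
  ∑ ℓ ∈ Finset.Icc 1 X, (Pcount σ ℓ : ℝ) / Λ ^ ℓ

/-- The Cesàro mean of the real sequence `a` (indexed from `1`) equals `B`. -/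
def CesaroLim (a : ℕ → ℝ) (B : ℝ) : Prop :=
  Tendsto (fun X : ℕ => (∑ k ∈ Finset.Icc 1 X, a k) / (X : ℝ)) atTop (𝓝 B)

/-- Extended-real logarithm, sending `0` (and negative numbers) to `-∞`. -/
def elog (x : ℝ) : EReal := if x ≤ 0 then ⊥ else ((Real.log x : ℝ) : EReal)

/-- The sequence `log(σ_k)/k`, with values in the extended reals
(so that `σ_k = 0` contributes `-∞`). -/
def growthSeq {𝒳 : Type*} (σ : 𝒳 → 𝒳) (k : ℕ) : EReal :=
  elog (fixCount σ k) * ((((k : ℝ)⁻¹ : ℝ)) : EReal)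

/-- The growth rate of `σ` is the (finite) real number `Λ`, i.e.
`limsup_{k→∞} log(σ_k)/k = log Λ` in the extended reals. -/
def GrowthEq {𝒳 : Type*} (σ : 𝒳 → 𝒳) (Λ : ℝ) : Prop :=
  Filter.limsup (growthSeq σ) atTop = ((Real.log Λ : ℝ) : EReal)

/-- The probability that a uniformly chosen general orbit of length at most `X`
satisfies the predicate `Q`. -/
def probN {𝒳 : Type*} (σ : 𝒳 → 𝒳) (X : ℕ) (Q : GenOrbit σ → Prop) : ℝ :=
  (Nat.card {O : GenOrbit σ // genLen O ≤ X ∧ Q O} : ℝ) / (Ncount σ X : ℝ)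

/-- `ω(O)`: the number of distinct prime orbits dividing the general orbit `O`. -/
def omegaCount {𝒳 : Type*} {σ : 𝒳 → 𝒳} (O : GenOrbit σ) : ℕ := O.support.card

/-- A function on general orbits is strongly additive if `g(P^k) = g(P)` for every prime
orbit `P` and `k ≥ 1`, and `g(O₁O₂) = g(O₁) + g(O₂)` for coprime general orbits. -/
def StronglyAdditive {𝒳 : Type*} {σ : 𝒳 → 𝒳} (g : GenOrbit σ → ℝ) : Prop :=
  (∀ (P : PrimeOrbit σ) (k : ℕ), 1 ≤ k →
      g (Finsupp.single P k) = g (Finsupp.single P 1)) ∧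
    ∀ O₁ O₂ : GenOrbit σ, Disjoint O₁.support O₂.support → g (O₁ + O₂) = g O₁ + g O₂

/-- The value of `g` on a prime orbit. -/
def gPrime {𝒳 : Type*} {σ : 𝒳 → 𝒳} (g : GenOrbit σ → ℝ) (P : PrimeOrbit σ) : ℝ :=
  g (Finsupp.single P 1)

/-- Condition (*): the Laplace transforms of the measures
`ρ_X = M_σ(X)⁻¹ Σ_{P ∈ 𝒫(X)} Λ^{-ℓ(P)} δ_{g(P)}` converge, for every `θ ∈ ℝ`, to the
(finite) Laplace transform of a probability measure `ρ` on `ℝ`. -/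
def LaplaceCondition {𝒳 : Type*} (σ : 𝒳 → 𝒳) (g : GenOrbit σ → ℝ) (Λ : ℝ)
    (ρ : Measure ℝ) : Prop :=
  IsProbabilityMeasure ρ ∧
    ∀ θ : ℝ,
      Integrable (fun y => Real.exp (θ * y)) ρ ∧
      Tendsto (fun X : ℕ => (Mfun σ Λ X)⁻¹ *
          ∑' P : {P : PrimeOrbit σ // orbitLen P ≤ X},
            ((Λ : ℝ) ^ orbitLen P.1)⁻¹ * Real.exp (θ * gPrime g P.1))
        atTop (𝓝 (∫ y, Real.exp (θ * y) ∂ρ))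

section PrimeOrbits

open Function

variable {𝒳 : Type*} {σ : 𝒳 → 𝒳}

/-- A prime orbit of length `ℓ` is the periodic orbit of a point of minimal period `ℓ`. -/
lemma PrimeOrbit.exists_generator (P : PrimeOrbit σ) :
    ∃ x, 0 < orbitLen P ∧ minimalPeriod σ x = orbitLen P ∧ P.1 = {z | z ∈ periodicOrbit σ x} := by
  obtain ⟨x, ℓ, hℓ, hP, hcard, hinv⟩ := P.2
  have hlen : orbitLen P = ℓ := hcard
  rw [hlen]
  have hinj : Set.InjOn (fun i => σ^[i] x) (Set.Iio ℓ) := by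
    refine Set.injOn_of_ncard_image_eq ?_ (Set.finite_Iio ℓ)
    rw [← hP, hcard, Set.ncard_eq_toFinset_card', Set.toFinset_Iio, Nat.card_Iio]
  have hxP : x ∈ σ '' P.1 := by
    rw [hinv, hP]
    exact ⟨0, hℓ, rfl⟩
  rw [hP] at hxP
  obtain ⟨_, ⟨i, hi, rfl⟩, hix⟩ := hxP
  have hper : IsPeriodicPt σ (i + 1) x := by
    rw [IsPeriodicPt, IsFixedPt, iterate_succ_apply']
    exact hix
  have hpos := hper.minimalPeriod_pos (Nat.succ_pos i)
  have hmin : minimalPeriod σ x = ℓ := by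
    refine le_antisymm ((hper.minimalPeriod_le (Nat.succ_pos i)).trans hi) ?_
    by_contra! hlt
    have := hinj (Set.mem_Iio.2 hlt) (Set.mem_Iio.2 hℓ)
      (show σ^[minimalPeriod σ x] x = σ^[0] x from isPeriodicPt_minimalPeriod σ x)
    omega
  refine ⟨x, hℓ, hmin, ?_⟩
  have hx : x ∈ periodicPts σ := minimalPeriod_pos_iff_mem_periodicPts.1 hpos
  ext z
  rw [Set.mem_ofPred_eq, mem_periodicOrbit_iff hx, hP]
  constructor
  · rintro ⟨n, -, rfl⟩
    exact ⟨n, rfl⟩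
  · rintro ⟨n, rfl⟩
    refine ⟨n % ℓ, Nat.mod_lt _ hℓ, ?_⟩
    rw [← hmin]
    exact iterate_mod_minimalPeriod_eq

lemma orbitLen_pos (P : PrimeOrbit σ) : 0 < orbitLen P :=
  P.exists_generator.choose_spec.1

lemma PrimeOrbit.eq_periodicOrbit (P : PrimeOrbit σ) {y : 𝒳} (hy : y ∈ P.1) :
    minimalPeriod σ y = orbitLen P ∧ P.1 = {z | z ∈ periodicOrbit σ y} := by
  obtain ⟨x, hpos, hx, hP⟩ := P.exists_generator
  have hxp : x ∈ periodicPts σ := minimalPeriod_pos_iff_mem_periodicPts.1 (hx ▸ hpos)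
  rw [hP, Set.mem_ofPred_eq, mem_periodicOrbit_iff hxp] at hy
  obtain ⟨n, rfl⟩ := hy
  rw [minimalPeriod_apply_iterate hxp, periodicOrbit_apply_iterate_eq hxp]
  exact ⟨hx, hP⟩

lemma exists_mem_primeOrbit {x : 𝒳} (hx : 0 < minimalPeriod σ x) :
    ∃ P : PrimeOrbit σ, orbitLen P = minimalPeriod σ x ∧ x ∈ P.1 := by
  have hncard : ((fun i => σ^[i] x) '' Set.Iio (minimalPeriod σ x)).ncard = minimalPeriod σ x := by
    rw [iterate_injOn_Iio_minimalPeriod.ncard_image, Set.ncard_eq_toFinset_card',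
      Set.toFinset_Iio, Nat.card_Iio]
  refine ⟨⟨(fun i => σ^[i] x) '' Set.Iio (minimalPeriod σ x), x, _, hx, rfl, hncard, ?_⟩,
    hncard, ⟨0, hx, rfl⟩⟩
  ext z
  constructor
  · rintro ⟨_, ⟨i, -, rfl⟩, rfl⟩
    refine ⟨(i + 1) % minimalPeriod σ x, Nat.mod_lt _ hx, ?_⟩
    simp only [iterate_mod_minimalPeriod_eq, iterate_succ_apply']
  · rintro ⟨i, -, rfl⟩
    refine ⟨_, ⟨(i + (minimalPeriod σ x - 1)) % minimalPeriod σ x, Nat.mod_lt _ hx, rfl⟩, ?_⟩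
    simp only [iterate_mod_minimalPeriod_eq]
    rw [← iterate_succ_apply' σ, Nat.succ_eq_add_one, add_assoc, Nat.sub_add_cancel hx,
      iterate_add_minimalPeriod_eq]

lemma PrimeOrbit.eq_of_mem {P Q : PrimeOrbit σ} {y : 𝒳} (hP : y ∈ P.1) (hQ : y ∈ Q.1) : P = Q :=
  Subtype.ext ((P.eq_periodicOrbit hP).2.trans (Q.eq_periodicOrbit hQ).2.symm)

lemma finite_primeOrbit_len_eq (hσ : Confined σ) (k : ℕ) :
    {P : PrimeOrbit σ | orbitLen P = k}.Finite := by
  rcases Nat.eq_zero_or_pos k with rfl | hk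
  · convert Set.finite_empty
    ext P
    simpa using (orbitLen_pos P).ne'
  · refine Set.Finite.of_finite_image (f := Subtype.val) ?_ Subtype.val_injective.injOn
    refine (hσ k hk).finite_subsets.subset ?_
    rintro _ ⟨P, hP, rfl⟩ y hy
    rw [Set.mem_ofPred_eq, ← hP, ← (P.eq_periodicOrbit hy).1]
    exact isPeriodicPt_minimalPeriod σ y

lemma finite_primeOrbit_len_le (hσ : Confined σ) (X : ℕ) :
    {P : PrimeOrbit σ | orbitLen P ≤ X}.Finite := by
  refine ((Set.finite_Iic X).biUnion fun k _ => finite_primeOrbit_len_eq hσ k).subset ?_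
  intro P hP
  simpa using hP

/-- Counting the points of minimal period `k` through the prime orbits containing them. -/
lemma ncard_minimalPeriod_eq (hσ : Confined σ) {k : ℕ} (hk : 0 < k) :
    {x | minimalPeriod σ x = k}.ncard = k * Pcount σ k := by
  have hfin := finite_primeOrbit_len_eq hσ k
  have hset : {x | minimalPeriod σ x = k} =
      ⋃ P ∈ {P : PrimeOrbit σ | orbitLen P = k}, P.1 := by
    ext x
    simp only [Set.mem_ofPred_eq, Set.mem_iUnion, exists_prop]
    constructor
    · intro hx
      obtain ⟨P, hP, hxP⟩ := exists_mem_primeOrbit (σ := σ) (x := x) (hx ▸ hk)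
      exact ⟨P, hP.trans hx, hxP⟩
    · rintro ⟨P, hP, hxP⟩
      exact (P.eq_periodicOrbit hxP).1.trans hP
  rw [hset, hfin.ncard_biUnion (fun P _ => Set.finite_of_ncard_pos (orbitLen_pos P))]
  · have hlen : ∀ P ∈ {P : PrimeOrbit σ | orbitLen P = k}, P.1.ncard = k := fun P hP => hP
    refine (finsum_mem_congr rfl hlen).trans ?_
    rw [finsum_mem_eq_finite_toFinset_sum _ hfin, Finset.sum_const, smul_eq_mul, mul_comm,
      ← Set.ncard_eq_toFinset_card _ hfin]
    rfl
  · intro P _ Q _ hPQ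
    exact Set.disjoint_left.2 fun y hP hQ => hPQ (PrimeOrbit.eq_of_mem hP hQ)

lemma mul_Pcount_le_fixCount (hσ : Confined σ) {k : ℕ} (hk : 0 < k) :
    k * Pcount σ k ≤ fixCount σ k := by
  rw [← ncard_minimalPeriod_eq hσ hk]
  refine Set.ncard_le_ncard (t := {x | σ^[k] x = x}) ?_ (hσ k hk)
  rintro x rfl
  exact isPeriodicPt_minimalPeriod σ x

lemma fixCount_le (hσ : Confined σ) {k : ℕ} (hk : 0 < k) :
    fixCount σ k ≤ k * Pcount σ k + ∑ d ∈ Finset.Icc 1 (k / 2), fixCount σ d := by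
  rw [← ncard_minimalPeriod_eq hσ hk]
  have hsub : {x | σ^[k] x = x} ⊆
      {x | minimalPeriod σ x = k} ∪ ⋃ d ∈ Finset.Icc 1 (k / 2), {x | σ^[d] x = x} := by
    intro x hx
    have hper : IsPeriodicPt σ k x := hx
    obtain ⟨m, hm⟩ := hper.minimalPeriod_dvd
    have hpos := hper.minimalPeriod_pos hk
    by_cases h : minimalPeriod σ x = k
    · exact Or.inl h
    · refine Or.inr (Set.mem_biUnion (x := minimalPeriod σ x) ?_ (isPeriodicPt_minimalPeriod σ x))
      have hm2 : 2 ≤ m := by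
        by_contra! hlt
        interval_cases m <;> omega
      simp only [Finset.coe_Icc, Set.mem_Icc]
      refine ⟨hpos, (Nat.le_div_iff_mul_le two_pos).2 ?_⟩
      calc minimalPeriod σ x * 2 ≤ minimalPeriod σ x * m := Nat.mul_le_mul_left _ hm2
        _ = k := hm.symm
  have hD : {x | minimalPeriod σ x = k}.Finite := (hσ k hk).subset (by
    rintro x rfl
    exact isPeriodicPt_minimalPeriod σ x)
  have hU : (⋃ d ∈ Finset.Icc 1 (k / 2), {x | σ^[d] x = x}).Finite :=
    (Finset.finite_toSet _).biUnion fun d hd => hσ d (Finset.mem_Icc.1 hd).1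
  refine (Set.ncard_le_ncard hsub (hD.union hU)).trans ((Set.ncard_union_le _ _).trans ?_)
  exact Nat.add_le_add_left (Finset.set_ncard_biUnion_le _ _) _

end PrimeOrbits

section Cesaro

variable {s : ℕ → ℝ} {A B : ℝ}

lemma CesaroLim.exists_sum_le (h : CesaroLim s B) :
    ∃ A : ℝ, 0 < A ∧ ∀ X : ℕ, ∑ k ∈ Finset.Icc 1 X, s k ≤ A * X := by
  obtain ⟨M, hM⟩ := h.bddAbove_range
  refine ⟨max M 1, by positivity, fun X => ?_⟩
  rcases Nat.eq_zero_or_pos X with rfl | hX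
  · simp
  · have hX' : (0 : ℝ) < X := by exact_mod_cast hX
    rw [← div_le_iff₀ hX']
    exact (hM ⟨X, rfl⟩).trans (le_max_left _ _)

/-- Partial summation: a linear bound on the sums of `s k` bounds the sums of `s k / k`. -/
lemma sum_div_le_mul_one_add_log (hA : 0 ≤ A) (h : ∀ X : ℕ, ∑ k ∈ Finset.Icc 1 X, s k ≤ A * X)
    (X : ℕ) : ∑ k ∈ Finset.Icc 1 X, s k / k ≤ A * (1 + Real.log X) := by
  have key : ∀ n : ℕ, ∑ k ∈ Finset.Icc 1 (n + 1), s k / k ≤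
      (∑ k ∈ Finset.Icc 1 (n + 1), s k) / (n + 1 : ℕ) + A * (harmonic (n + 1) - 1) := by
    intro n
    induction n with
    | zero => simp
    | succ n ih =>
      rw [Finset.sum_Icc_succ_top (by omega), Finset.sum_Icc_succ_top (by omega) s, harmonic_succ]
      have hS := h (n + 1)
      set S := ∑ k ∈ Finset.Icc 1 (n + 1), s k
      push_cast at ih hS ⊢
      have h1 : S / (n + 1) - S / (n + 1 + 1) ≤ A * (n + 1 + 1 : ℝ)⁻¹ := by
        have : S / (n + 1) - S / (n + 1 + 1) = S / (n + 1) * (n + 1 + 1 : ℝ)⁻¹ := by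
          field_simp
          ring
        rw [this]
        gcongr
        rwa [div_le_iff₀ (by positivity)]
      rw [add_div]
      linarith
  rcases X with _ | n
  · simpa using hA
  · refine (key n).trans ?_
    have h1 : (∑ k ∈ Finset.Icc 1 (n + 1), s k) / (n + 1 : ℕ) ≤ A := by
      rw [div_le_iff₀ (by positivity)]
      exact h (n + 1)
    have h2 := mul_le_mul_of_nonneg_left (harmonic_le_one_add_log (n + 1)) hA
    push_cast at h1 h2 ⊢
    linarith

lemma CesaroLim.eventually_le_sum_Ioc (h : CesaroLim s B) (hB : 0 < B) :
    ∀ᶠ T : ℕ in atTop, B / 4 * T ≤ ∑ k ∈ Finset.Ioc (T / 2) T, s k := by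
  have h2 : Tendsto (fun T : ℕ => T / 2) atTop atTop :=
    Nat.tendsto_div_const_atTop two_ne_zero
  filter_upwards [h.eventually_const_le (show B - B / 6 < B by linarith),
    (h.comp h2).eventually_le_const (show B < B + B / 6 by linarith),
    eventually_ge_atTop 2] with T hT hT2 hT3
  have hpos : (0 : ℝ) < T := by positivity
  have hpos2 : (0 : ℝ) < (T / 2 : ℕ) := by
    have : 0 < T / 2 := by omega
    exact_mod_cast this
  simp only [Function.comp] at hT2
  rw [le_div_iff₀ hpos] at hT
  rw [div_le_iff₀ hpos2] at hT2
  have hle : ((T / 2 : ℕ) : ℝ) ≤ T / 2 := Nat.cast_div_le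
  have hsplit : ∑ k ∈ Finset.Icc 1 T, s k =
      ∑ k ∈ Finset.Icc 1 (T / 2), s k + ∑ k ∈ Finset.Ioc (T / 2) T, s k := by
    have hIcc : ∀ n, Finset.Icc 1 n = Finset.Ioc 0 n := fun n => by ext; simp; omega
    rw [hIcc, hIcc]
    exact (Finset.sum_Ioc_consecutive s (Nat.zero_le _) (Nat.div_le_self _ _)).symm
  nlinarith

end Cesaro

section PrimeCount

variable {𝒳 : Type*} {σ : 𝒳 → 𝒳} {Λ A B : ℝ}

lemma Mfun_le (hσ : Confined σ) (hΛ : 1 < Λ) (hA : 0 ≤ A)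
    (h : ∀ X : ℕ, ∑ k ∈ Finset.Icc 1 X, (fixCount σ k : ℝ) / Λ ^ k ≤ A * X) (X : ℕ) :
    Mfun σ Λ X ≤ A * (1 + Real.log X) := by
  refine le_trans (Finset.sum_le_sum fun k hk => ?_) (sum_div_le_mul_one_add_log hA h X)
  have hk0 := (Finset.mem_Icc.1 hk).1
  have hk0' : (0 : ℝ) < k := by exact_mod_cast hk0
  have hle : (k : ℝ) * Pcount σ k ≤ fixCount σ k := by exact_mod_cast mul_Pcount_le_fixCount hσ hk0
  rw [div_right_comm]
  gcongr
  rw [le_div_iff₀ hk0']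
  linarith

/-- Prime orbits dominate the fixed points of `σ^k`, up to an error which is `o(Λ ^ k)`. -/
lemma eventually_fixCount_le (hσ : Confined σ) (hΛ : 1 < Λ)
    (h : ∀ X : ℕ, ∑ k ∈ Finset.Icc 1 X, (fixCount σ k : ℝ) / Λ ^ k ≤ A * X)
    (hA : 0 < A) {δ : ℝ} (hδ : 0 < δ) :
    ∀ᶠ k : ℕ in atTop, (fixCount σ k : ℝ) / Λ ^ k ≤ k * (Pcount σ k / Λ ^ k) + δ := by
  have hdiv : Tendsto (fun k : ℕ => k / 2) atTop atTop := Nat.tendsto_div_const_atTop two_ne_zero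
  have hlim := (tendsto_pow_const_div_const_pow_of_one_lt 1 hΛ).comp hdiv
  filter_upwards [hlim.eventually_le_const (show 0 < δ / A by positivity),
    eventually_ge_atTop 2] with k hk hk2
  have hΛ0 : 0 < Λ := by linarith
  set n := k / 2 with hn
  simp only [Function.comp, pow_one, ← hn] at hk
  rw [div_le_div_iff₀ (by positivity) hA] at hk
  have hsum : ∑ d ∈ Finset.Icc 1 n, (fixCount σ d : ℝ) ≤ Λ ^ n * (A * n) := by
    refine le_trans ?_ (mul_le_mul_of_nonneg_left (h n) (by positivity))
    rw [Finset.mul_sum]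
    refine Finset.sum_le_sum fun d hd => ?_
    rw [mul_div_assoc', le_div_iff₀ (by positivity), mul_comm]
    gcongr
    · exact hΛ.le
    · exact (Finset.mem_Icc.1 hd).2
  have hfix : (fixCount σ k : ℝ) ≤
      k * Pcount σ k + ∑ d ∈ Finset.Icc 1 n, (fixCount σ d : ℝ) := by
    exact_mod_cast fixCount_le hσ (show 0 < k by omega)
  have hpow : Λ ^ n * Λ ^ n ≤ Λ ^ k := by
    rw [← pow_add]
    exact pow_le_pow_right₀ hΛ.le (by omega)
  rw [mul_div_assoc', div_add' _ _ _ (by positivity)]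
  gcongr
  have h1 : Λ ^ n * (A * n) ≤ Λ ^ n * (δ * Λ ^ n) :=
    mul_le_mul_of_nonneg_left (by linarith) (by positivity)
  have h2 : δ * (Λ ^ n * Λ ^ n) ≤ δ * Λ ^ k := by gcongr
  linarith

lemma eventually_le_sum_Pcount (hσ : Confined σ) (hΛ : 1 < Λ)
    (hB : CesaroLim (fun k => (fixCount σ k : ℝ) / Λ ^ k) B) (hBpos : 0 < B) :
    ∀ᶠ T : ℕ in atTop, B / 8 ≤ ∑ k ∈ Finset.Ioc (T / 2) T, (Pcount σ k : ℝ) / Λ ^ k := by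
  obtain ⟨A, hA, hS⟩ := hB.exists_sum_le
  obtain ⟨k₀, hk₀⟩ := eventually_atTop.1
    (eventually_fixCount_le hσ hΛ hS hA (show 0 < B / 8 by positivity))
  filter_upwards [hB.eventually_le_sum_Ioc hBpos, eventually_ge_atTop (2 * k₀ + 1)] with T hT hTk
  have hTpos : (0 : ℝ) < T := by
    have : 0 < T := by omega
    exact_mod_cast this
  have hΛ0 : 0 < Λ := by linarith
  have hle : ∑ k ∈ Finset.Ioc (T / 2) T, (fixCount σ k : ℝ) / Λ ^ k ≤
      ∑ k ∈ Finset.Ioc (T / 2) T, (T * ((Pcount σ k : ℝ) / Λ ^ k) + B / 8) := by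
    refine Finset.sum_le_sum fun k hk => ?_
    rw [Finset.mem_Ioc] at hk
    refine (hk₀ k (by omega)).trans ?_
    gcongr
    exact hk.2
  rw [Finset.sum_add_distrib, ← Finset.mul_sum, Finset.sum_const, Nat.card_Ioc, nsmul_eq_mul] at hle
  have hcard : ((T - T / 2 : ℕ) : ℝ) ≤ T := by exact_mod_cast Nat.sub_le _ _
  have := mul_le_mul_of_nonneg_right hcard (show 0 ≤ B / 8 by positivity)
  refine le_of_mul_le_mul_left ?_ hTpos
  linarith

end PrimeCount

section GeneralOrbits

variable {𝒳 : Type*} {σ : 𝒳 → 𝒳} {Λ B : ℝ}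

lemma genLen_add_single (O : GenOrbit σ) (P : PrimeOrbit σ) :
    genLen (O + Finsupp.single P 1) = genLen O + orbitLen P := by
  rw [genLen, Finsupp.sum_add_index' (by simp) (by intros; ring), Finsupp.sum_single_index (by simp),
    one_mul, genLen]

lemma mul_orbitLen_le_genLen (O : GenOrbit σ) (P : PrimeOrbit σ) :
    O P * orbitLen P ≤ genLen O := by
  by_cases hP : P ∈ O.support
  · exact Finset.single_le_sum (f := fun P => O P * orbitLen P) (fun _ _ => Nat.zero_le _) hP
  · simp [Finsupp.notMem_support_iff.1 hP]

lemma orbitLen_le_genLen {O : GenOrbit σ} {P : PrimeOrbit σ} (hP : P ∈ O.support) :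
    orbitLen P ≤ genLen O :=
  (Nat.le_mul_of_pos_left _ (Nat.pos_of_ne_zero (Finsupp.mem_support_iff.1 hP))).trans
    (mul_orbitLen_le_genLen O P)

/-- The prime orbits of length at most `X`. -/
def primeFinset (hσ : Confined σ) (X : ℕ) : Finset (PrimeOrbit σ) :=
  (finite_primeOrbit_len_le hσ X).toFinset

@[simp]
lemma mem_primeFinset {hσ : Confined σ} {X : ℕ} {P : PrimeOrbit σ} :
    P ∈ primeFinset hσ X ↔ orbitLen P ≤ X := by
  simp [primeFinset]

lemma mem_finsupp_of_genLen_le (hσ : Confined σ) {X : ℕ} {O : GenOrbit σ} (hO : genLen O ≤ X) :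
    O ∈ (primeFinset hσ X).finsupp fun _ => Finset.range (X + 1) := by
  refine Finset.mem_finsupp_iff.2 ⟨fun P hP => ?_, fun P _ => ?_⟩
  · exact mem_primeFinset.2 ((orbitLen_le_genLen hP).trans hO)
  · have := (Nat.le_mul_of_pos_right _ (orbitLen_pos P)).trans
      ((mul_orbitLen_le_genLen O P).trans hO)
    exact Finset.mem_range.2 (Nat.lt_succ_of_le this)

lemma finite_genOrbit_len_le (hσ : Confined σ) (X : ℕ) : {O : GenOrbit σ | genLen O ≤ X}.Finite :=
  (Finset.finite_toSet _).subset fun _ hO => mem_finsupp_of_genLen_le hσ hO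

/-- The general orbits of length at most `X`. -/
def genFinset (hσ : Confined σ) (X : ℕ) : Finset (GenOrbit σ) :=
  (finite_genOrbit_len_le hσ X).toFinset

@[simp]
lemma mem_genFinset {hσ : Confined σ} {X : ℕ} {O : GenOrbit σ} :
    O ∈ genFinset hσ X ↔ genLen O ≤ X := by
  simp [genFinset]

lemma card_genFinset_filter (hσ : Confined σ) (X : ℕ) (Q : GenOrbit σ → Prop) :
    Nat.card {O : GenOrbit σ // genLen O ≤ X ∧ Q O} = ((genFinset hσ X).filter Q).card := by
  refine Nat.subtype_card _ fun O => ?_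
  rw [Finset.mem_filter, mem_genFinset]

lemma card_genFinset (hσ : Confined σ) (X : ℕ) : Ncount σ X = (genFinset hσ X).card :=
  Nat.subtype_card _ fun _ => mem_genFinset

lemma Pcount_eq_card_filter (hσ : Confined σ) {k X : ℕ} (hk : k ≤ X) :
    Pcount σ k = ((primeFinset hσ X).filter fun P => orbitLen P = k).card := by
  refine Nat.subtype_card _ fun P => ?_
  rw [Finset.mem_filter, mem_primeFinset]
  omega

lemma Mfun_eq_sum_primeFinset (hσ : Confined σ) (X : ℕ) :
    Mfun σ Λ X = ∑ P ∈ primeFinset hσ X, (Λ ^ orbitLen P)⁻¹ := by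
  rw [← Finset.sum_fiberwise_of_maps_to (t := Finset.Icc 1 X) (g := orbitLen)
    (fun P hP => Finset.mem_Icc.2 ⟨orbitLen_pos P, mem_primeFinset.1 hP⟩)]
  refine Finset.sum_congr rfl fun k hk => ?_
  rw [Pcount_eq_card_filter hσ (Finset.mem_Icc.1 hk).2, div_eq_mul_inv, ← nsmul_eq_mul]
  refine (Finset.sum_eq_card_nsmul fun P hP => ?_).symm
  rw [(Finset.mem_filter.1 hP).2]

lemma Ncount_pos (hσ : Confined σ) (X : ℕ) : 0 < Ncount σ X := by
  rw [card_genFinset hσ]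
  exact Finset.card_pos.2 ⟨0, by simp [genLen]⟩

/-- Adjoining a prime orbit longer than `T / 2` to a shorter general orbit is injective. -/
lemma sum_Pcount_mul_Ncount_le (hσ : Confined σ) (T : ℕ) :
    ∑ k ∈ Finset.Ioc (T / 2) T, Pcount σ k * Ncount σ (T - k) ≤ Ncount σ T := by
  have hsum : ∑ k ∈ Finset.Ioc (T / 2) T, Pcount σ k * Ncount σ (T - k) =
      ((Finset.Ioc (T / 2) T).sigma fun k =>
        ((primeFinset hσ T).filter fun P => orbitLen P = k) ×ˢ genFinset hσ (T - k)).card := by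
    rw [Finset.card_sigma]
    refine Finset.sum_congr rfl fun k hk => ?_
    rw [Finset.card_product, ← Pcount_eq_card_filter hσ (Finset.mem_Ioc.1 hk).2,
      ← card_genFinset hσ]
  rw [hsum, card_genFinset hσ T]
  refine Finset.card_le_card_of_injOn (fun a => a.2.2 + Finsupp.single a.2.1 1) ?_ ?_
  · rintro ⟨k, P, O⟩ ha
    simp only [Finset.coe_sigma, Set.mem_sigma_iff, Finset.mem_coe, Finset.mem_Ioc,
      Finset.mem_product, Finset.mem_filter, mem_primeFinset, mem_genFinset] at ha ⊢
    rw [genLen_add_single]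
    omega
  · rintro ⟨k, P, O⟩ ha ⟨k', P', O'⟩ ha' heq
    simp only [Finset.coe_sigma, Set.mem_sigma_iff, Finset.mem_coe, Finset.mem_Ioc,
      Finset.mem_product, Finset.mem_filter, mem_primeFinset, mem_genFinset] at ha ha' heq
    have hPP : P = P' := by
      by_contra hne
      have happ := DFunLike.congr_fun heq P'
      rw [Finsupp.add_apply, Finsupp.add_apply, Finsupp.single_eq_same,
        Finsupp.single_eq_of_ne (Ne.symm hne)] at happ
      have hmem : P' ∈ O.support := Finsupp.mem_support_iff.2 (by omega)
      have := orbitLen_le_genLen hmem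
      omega
    subst hPP
    obtain rfl := add_right_cancel heq
    obtain rfl : k = k' := ha.2.1.2.symm.trans ha'.2.1.2
    rfl

/-- The number of general orbits of length at most `T` is at least `Λ ^ T`, up to a polynomial
factor. -/
lemma exists_mul_pow_le_Ncount (hσ : Confined σ) (hΛ : 1 < Λ)
    (hB : CesaroLim (fun k => (fixCount σ k : ℝ) / Λ ^ k) B) (hBpos : 0 < B) :
    ∃ (c : ℝ) (K : ℕ), 0 < c ∧ ∀ T : ℕ, c * Λ ^ T ≤ Ncount σ T * ((T : ℝ) + 1) ^ K := by
  obtain ⟨T₀, hT₀⟩ := eventually_atTop.1 (eventually_le_sum_Pcount hσ hΛ hB hBpos)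
  obtain ⟨K, hK⟩ := pow_unbounded_of_one_lt (8 / B) (show (1 : ℝ) < 4 / 3 by norm_num)
  have hΛ0 : 0 < Λ := by linarith
  refine ⟨(Λ ^ (T₀ + 1))⁻¹, K, by positivity, fun T => ?_⟩
  induction T using Nat.strong_induction_on with
  | _ T ih =>
    rcases lt_or_ge T (T₀ + 1) with hlt | hge
    · have h1 : (1 : ℝ) ≤ Ncount σ T := by exact_mod_cast Ncount_pos hσ T
      have h2 : (1 : ℝ) ≤ ((T : ℝ) + 1) ^ K := one_le_pow₀ (by linarith [T.cast_nonneg (α := ℝ)])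
      refine le_trans ?_ (one_le_mul_of_one_le_of_one_le h1 h2)
      rw [inv_mul_le_iff₀ (by positivity), mul_one]
      exact pow_le_pow_right₀ hΛ.le hlt.le
    · set c := (Λ ^ (T₀ + 1))⁻¹ with hc
      have hc0 : 0 < c := by positivity
      have hterm : ∀ k ∈ Finset.Ioc (T / 2) T, (4 / 3 : ℝ) ^ K * (c * Λ ^ T) *
          (Pcount σ k / Λ ^ k) ≤ Pcount σ k * Ncount σ (T - k) * ((T : ℝ) + 1) ^ K := by
        intro k hk
        rw [Finset.mem_Ioc] at hk
        have hpow : Λ ^ T = Λ ^ (T - k) * Λ ^ k := by rw [← pow_add, Nat.sub_add_cancel hk.2]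
        have hnat : 4 * ((T - k) + 1) ≤ 3 * (T + 1) := by omega
        have hreal : (4 / 3 : ℝ) * (((T - k : ℕ) : ℝ) + 1) ≤ T + 1 := by
          have : (4 : ℝ) * (((T - k : ℕ) : ℝ) + 1) ≤ 3 * (T + 1) := by exact_mod_cast hnat
          linarith
        calc (4 / 3 : ℝ) ^ K * (c * Λ ^ T) * (Pcount σ k / Λ ^ k)
            = Pcount σ k * ((4 / 3 : ℝ) ^ K * (c * Λ ^ (T - k))) := by
              rw [hpow]
              field_simp
          _ ≤ Pcount σ k * ((4 / 3 : ℝ) ^ K *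
                (Ncount σ (T - k) * (((T - k : ℕ) : ℝ) + 1) ^ K)) := by
              have := ih (T - k) (by omega)
              exact mul_le_mul_of_nonneg_left
                (mul_le_mul_of_nonneg_left this (by positivity)) (Nat.cast_nonneg _)
          _ = Pcount σ k * Ncount σ (T - k) * ((4 / 3 : ℝ) * (((T - k : ℕ) : ℝ) + 1)) ^ K := by
              rw [mul_pow]
              ring
          _ ≤ _ := by gcongr
      have hsum := Finset.sum_le_sum hterm
      rw [← Finset.mul_sum, ← Finset.sum_mul] at hsum
      have hN : ∑ k ∈ Finset.Ioc (T / 2) T, (Pcount σ k : ℝ) * Ncount σ (T - k) ≤ Ncount σ T := by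
        exact_mod_cast sum_Pcount_mul_Ncount_le hσ T
      have hlow := hT₀ T (by omega)
      calc c * Λ ^ T = (8 / B) * (c * Λ ^ T) * (B / 8) := by field_simp
        _ ≤ (4 / 3 : ℝ) ^ K * (c * Λ ^ T) *
            ∑ k ∈ Finset.Ioc (T / 2) T, (Pcount σ k : ℝ) / Λ ^ k := by gcongr
        _ ≤ _ := hsum.trans (by gcongr)

/-- Rankin's trick combined with the Euler product bound. -/
lemma sum_genFinset_prod_le (hσ : Confined σ) (hΛ : 1 < Λ) {h : PrimeOrbit σ → ℝ}
    (hh : ∀ P, 0 ≤ h P) (X : ℕ) :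
    ∑ O ∈ genFinset hσ X, ∏ P ∈ O.support, h P ≤
      Λ ^ X * Real.exp (Λ / (Λ - 1) * ∑ P ∈ primeFinset hσ X, h P * (Λ ^ orbitLen P)⁻¹) := by
  have hΛ0 : 0 < Λ := by linarith
  set f : PrimeOrbit σ → ℕ → ℝ :=
    fun P m => if m = 0 then 1 else h P * ((Λ ^ orbitLen P)⁻¹) ^ m with hf
  have hf0 : ∀ P m, 0 ≤ f P m := by
    intro P m
    simp only [hf]
    split_ifs
    · exact zero_le_one
    · have := hh P
      positivity
  have hterm : ∀ O ∈ genFinset hσ X, ∏ P ∈ O.support, h P ≤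
      Λ ^ X * ∏ P ∈ primeFinset hσ X, f P (O P) := by
    intro O hO
    rw [mem_genFinset] at hO
    have hsub : O.support ⊆ primeFinset hσ X := fun P hP =>
      mem_primeFinset.2 ((orbitLen_le_genLen hP).trans hO)
    have hprod : ∏ P ∈ primeFinset hσ X, f P (O P) = (∏ P ∈ O.support, h P) * (Λ ^ genLen O)⁻¹ := by
      rw [← Finset.prod_subset hsub fun P _ hP => by simp [hf, Finsupp.notMem_support_iff.1 hP],
        genLen, Finsupp.sum, ← Finset.prod_pow_eq_pow_sum, ← Finset.prod_inv_distrib,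
        ← Finset.prod_mul_distrib]
      refine Finset.prod_congr rfl fun P hP => ?_
      simp only [hf, Finsupp.mem_support_iff.1 hP, if_false]
      rw [inv_pow, ← pow_mul, mul_comm (orbitLen P)]
    rw [hprod, mul_left_comm]
    refine le_mul_of_one_le_right (Finset.prod_nonneg fun P _ => hh P) ?_
    rw [← div_eq_mul_inv, one_le_div (by positivity)]
    exact pow_le_pow_right₀ hΛ.le hO
  have hfactor : ∀ P, ∑ m ∈ Finset.range (X + 1), f P m ≤
      Real.exp (Λ / (Λ - 1) * (h P * (Λ ^ orbitLen P)⁻¹)) := by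
    intro P
    set x := (Λ ^ orbitLen P)⁻¹ with hx
    have hx0 : 0 < x := by positivity
    have hxle : x ≤ Λ⁻¹ := by
      rw [hx]
      gcongr
      exact le_self_pow₀ hΛ.le (orbitLen_pos P).ne'
    have hgap : (Λ - 1) / Λ ≤ 1 - x := by
      rw [sub_div, div_self hΛ0.ne', one_div]
      linarith
    have hgeom : ∑ m ∈ Finset.range X, x ^ m ≤ Λ / (Λ - 1) := by
      have hmul := geom_sum_mul x X
      have hpow : 0 ≤ x ^ X := by positivity
      have hpos : 0 < (Λ - 1) / Λ := div_pos (by linarith) hΛ0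
      rw [← inv_div (Λ - 1) Λ, ← one_div]
      refine le_trans ?_ (one_div_le_one_div_of_le hpos hgap)
      rw [le_div_iff₀ (by linarith)]
      linarith
    rw [Finset.sum_range_succ']
    simp only [hf, if_true, Nat.succ_ne_zero, if_false, pow_succ]
    rw [← Finset.mul_sum, ← Finset.sum_mul]
    have hhP := hh P
    calc h P * ((∑ m ∈ Finset.range X, x ^ m) * x) + 1
        ≤ h P * (Λ / (Λ - 1) * x) + 1 := by gcongr
      _ = Λ / (Λ - 1) * (h P * x) + 1 := by ring
      _ ≤ _ := Real.add_one_le_exp _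
  calc ∑ O ∈ genFinset hσ X, ∏ P ∈ O.support, h P
      ≤ ∑ O ∈ genFinset hσ X, Λ ^ X * ∏ P ∈ primeFinset hσ X, f P (O P) :=
        Finset.sum_le_sum hterm
    _ = Λ ^ X * ∑ O ∈ genFinset hσ X, ∏ P ∈ primeFinset hσ X, f P (O P) := by rw [Finset.mul_sum]
    _ ≤ Λ ^ X * ∑ O ∈ (primeFinset hσ X).finsupp fun _ => Finset.range (X + 1),
          ∏ P ∈ primeFinset hσ X, f P (O P) := by
        refine mul_le_mul_of_nonneg_left ?_ (by positivity)
        refine Finset.sum_le_sum_of_subset_of_nonneg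
          (fun O hO => mem_finsupp_of_genLen_le hσ (mem_genFinset.1 hO))
          fun O _ _ => Finset.prod_nonneg fun P _ => hf0 P _
    _ = Λ ^ X * ∏ P ∈ primeFinset hσ X, ∑ m ∈ Finset.range (X + 1), f P m := by
        rw [Finset.prod_sum, Finset.finsupp, Finset.sum_map]
        congr 1
        refine Finset.sum_congr (by congr!) fun p _ => ?_
        rw [← Finset.prod_attach]
        refine Finset.prod_congr rfl fun P _ => ?_
        simp [Finsupp.indicator_of_mem P.2]
    _ ≤ Λ ^ X * ∏ P ∈ primeFinset hσ X, Real.exp (Λ / (Λ - 1) * (h P * (Λ ^ orbitLen P)⁻¹)) := by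
        gcongr with P
        · exact fun P _ => Finset.sum_nonneg fun m _ => hf0 P m
        · exact hfactor P
    _ = _ := by rw [← Real.exp_sum, Finset.mul_sum]

end GeneralOrbits

section Chernoff

variable {𝒳 : Type*} {σ : 𝒳 → 𝒳} {Λ B : ℝ} {g : GenOrbit σ → ℝ} {ρ : Measure ℝ}

/-- The exponential weight `exp (θ |g P|)` of a prime orbit with `|g P| > C`, and `1` otherwise. -/
def truncWeight (g : GenOrbit σ → ℝ) (θ C : ℝ) (P : PrimeOrbit σ) : ℝ :=
  if C < |gPrime g P| then Real.exp (θ * |gPrime g P|) else 1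

lemma truncWeight_nonneg (g : GenOrbit σ → ℝ) (θ C : ℝ) (P : PrimeOrbit σ) :
    0 ≤ truncWeight g θ C P := by
  rw [truncWeight]
  split_ifs
  · exact (Real.exp_pos _).le
  · exact zero_le_one

lemma truncWeight_le (g : GenOrbit σ → ℝ) (θ C : ℝ) (P : PrimeOrbit σ) :
    truncWeight g θ C P ≤ 1 + Real.exp (-C) *
      (Real.exp ((θ + 1) * gPrime g P) + Real.exp (-(θ + 1) * gPrime g P)) := by
  rw [truncWeight]
  split_ifs with hC
  · have h1 : Real.exp (θ * |gPrime g P|) ≤ Real.exp (-C) * Real.exp ((θ + 1) * |gPrime g P|) := by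
      rw [← Real.exp_add, Real.exp_le_exp]
      linarith
    have h2 : Real.exp ((θ + 1) * |gPrime g P|) ≤
        Real.exp ((θ + 1) * gPrime g P) + Real.exp (-(θ + 1) * gPrime g P) := by
      rcases abs_choice (gPrime g P) with h | h <;> rw [h]
      · exact le_add_of_nonneg_right (Real.exp_pos _).le
      · rw [mul_neg, ← neg_mul]
        exact le_add_of_nonneg_left (Real.exp_pos _).le
    have h3 := mul_le_mul_of_nonneg_left h2 (Real.exp_pos (-C)).le
    linarith
  · have := Real.exp_pos (-C)
    exact le_add_of_nonneg_right (by positivity)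

/-- Chernoff's bound for the contribution of the large values of `g`. -/
lemma card_filter_le (hσ : Confined σ) (hΛ : 1 < Λ) (g : GenOrbit σ → ℝ) {θ : ℝ} (hθ : 0 ≤ θ)
    (C L : ℝ) (X : ℕ) :
    (((genFinset hσ X).filter fun O => L ≤ |∑ P ∈ O.support.filter
      (fun P => orbitLen P ≤ X ∧ C < |gPrime g P|), gPrime g P|).card : ℝ) ≤
    Real.exp (-(θ * L)) * (Λ ^ X * Real.exp (Λ / (Λ - 1) *
      ∑ P ∈ primeFinset hσ X, truncWeight g θ C P * (Λ ^ orbitLen P)⁻¹)) := by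
  refine le_trans ?_ (mul_le_mul_of_nonneg_left
    (sum_genFinset_prod_le hσ hΛ (truncWeight_nonneg g θ C) X) (Real.exp_pos _).le)
  rw [Finset.mul_sum, Finset.card_eq_sum_ones, Nat.cast_sum, Finset.sum_filter]
  refine Finset.sum_le_sum fun O _ => ?_
  split_ifs with hL
  · have hle : L ≤ ∑ P ∈ O.support.filter (fun P => C < |gPrime g P|), |gPrime g P| := by
      refine hL.trans ((Finset.abs_sum_le_sum_abs _ _).trans ?_)
      refine Finset.sum_le_sum_of_subset_of_nonneg ?_ fun _ _ _ => abs_nonneg _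
      exact Finset.monotone_filter_right _ fun P _ hP => hP.2
    have hprod : ∏ P ∈ O.support, truncWeight g θ C P =
        Real.exp (θ * ∑ P ∈ O.support.filter (fun P => C < |gPrime g P|), |gPrime g P|) := by
      simp only [truncWeight]
      rw [← Finset.prod_filter, ← Real.exp_sum, Finset.mul_sum]
    rw [hprod, ← Real.exp_add, Nat.cast_one]
    refine Real.one_le_exp ?_
    have := mul_le_mul_of_nonneg_left hle hθ
    linarith
  · exact mul_nonneg (Real.exp_pos _).le (Finset.prod_nonneg fun P _ => truncWeight_nonneg g θ C P)

lemma LaplaceCondition.eventually_sum_le (hσ : Confined σ) (hΛ : 1 < Λ)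
    (hρ : LaplaceCondition σ g Λ ρ) (θ : ℝ) :
    ∃ D : ℝ, ∀ᶠ X : ℕ in atTop, ∑ P ∈ primeFinset hσ X, Real.exp (θ * gPrime g P) *
      (Λ ^ orbitLen P)⁻¹ ≤ D * Mfun σ Λ X := by
  have := hρ.1
  obtain ⟨hint, hlim⟩ := hρ.2 θ
  have hpos : 0 < ∫ y, Real.exp (θ * y) ∂ρ := integral_exp_pos hint
  refine ⟨∫ y, Real.exp (θ * y) ∂ρ + 1, ?_⟩
  filter_upwards [hlim.eventually_const_lt hpos,
    hlim.eventually_le_const (lt_add_one _)] with X hX0 hX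
  have htsum : ∑' P : {P : PrimeOrbit σ // orbitLen P ≤ X},
      ((Λ : ℝ) ^ orbitLen P.1)⁻¹ * Real.exp (θ * gPrime g P.1) =
      ∑ P ∈ primeFinset hσ X, Real.exp (θ * gPrime g P) * (Λ ^ orbitLen P)⁻¹ := by
    have : Fintype {P : PrimeOrbit σ // orbitLen P ≤ X} := (finite_primeOrbit_len_le hσ X).fintype
    rw [tsum_fintype]
    refine (Finset.sum_subtype (primeFinset hσ X) (fun P => mem_primeFinset)
      fun P => ((Λ : ℝ) ^ orbitLen P)⁻¹ * Real.exp (θ * gPrime g P)).symm.trans ?_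
    exact Finset.sum_congr rfl fun P _ => mul_comm _ _
  rw [htsum] at hX0 hX
  have hM : Mfun σ Λ X ≠ 0 := by
    intro h
    simp [h] at hX0
  have hM0 : 0 < Mfun σ Λ X := by
    refine lt_of_le_of_ne (Finset.sum_nonneg fun k _ => ?_) hM.symm
    have : 0 < Λ := by linarith
    positivity
  rwa [inv_mul_le_iff₀ hM0, mul_comm] at hX

/-- For large `C` the truncated exponential weights have mean at most `2`. -/
lemma LaplaceCondition.eventually_sum_truncWeight_le (hσ : Confined σ) (hΛ : 1 < Λ)
    (hρ : LaplaceCondition σ g Λ ρ) (θ : ℝ) :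
    ∀ᶠ C : ℝ in atTop, ∀ᶠ X : ℕ in atTop, ∑ P ∈ primeFinset hσ X,
      truncWeight g θ C P * (Λ ^ orbitLen P)⁻¹ ≤ 2 * Mfun σ Λ X := by
  obtain ⟨D₁, hD₁⟩ := hρ.eventually_sum_le hσ hΛ (θ + 1)
  obtain ⟨D₂, hD₂⟩ := hρ.eventually_sum_le hσ hΛ (-(θ + 1))
  have hΛ0 : 0 < Λ := by linarith
  have hlim : Tendsto (fun C : ℝ => Real.exp (-C) * (D₁ + D₂)) atTop (𝓝 0) := by
    simpa using (Real.tendsto_exp_neg_atTop_nhds_zero).mul_const (D₁ + D₂)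
  filter_upwards [hlim.eventually_le_const one_pos] with C hC
  filter_upwards [hD₁, hD₂] with X hX₁ hX₂
  have hM0 : 0 ≤ Mfun σ Λ X := Finset.sum_nonneg fun k _ => by positivity
  calc ∑ P ∈ primeFinset hσ X, truncWeight g θ C P * (Λ ^ orbitLen P)⁻¹
      ≤ ∑ P ∈ primeFinset hσ X, (1 + Real.exp (-C) * (Real.exp ((θ + 1) * gPrime g P) +
          Real.exp (-(θ + 1) * gPrime g P))) * (Λ ^ orbitLen P)⁻¹ := by
        gcongr with P
        exact truncWeight_le g θ C P
    _ = Mfun σ Λ X + Real.exp (-C) *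
          (∑ P ∈ primeFinset hσ X, Real.exp ((θ + 1) * gPrime g P) * (Λ ^ orbitLen P)⁻¹ +
           ∑ P ∈ primeFinset hσ X, Real.exp (-(θ + 1) * gPrime g P) * (Λ ^ orbitLen P)⁻¹) := by
        rw [Mfun_eq_sum_primeFinset hσ, ← Finset.sum_add_distrib, Finset.mul_sum,
          ← Finset.sum_add_distrib]
        exact Finset.sum_congr rfl fun P _ => by ring
    _ ≤ Mfun σ Λ X + Real.exp (-C) * (D₁ * Mfun σ Λ X + D₂ * Mfun σ Λ X) := by gcongr
    _ = Mfun σ Λ X + Real.exp (-C) * (D₁ + D₂) * Mfun σ Λ X := by ring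
    _ ≤ Mfun σ Λ X + 1 * Mfun σ Λ X := by gcongr
    _ = 2 * Mfun σ Λ X := by ring

/-- The probability of a large contribution of the values of `g` beyond `C` decays faster than any
prescribed power of `X`, once `C` is large. -/
lemma eventually_probN_le (hσ : Confined σ) (hΛ : 1 < Λ)
    (hB : CesaroLim (fun k => (fixCount σ k : ℝ) / Λ ^ k) B) (hBpos : 0 < B)
    (hρ : LaplaceCondition σ g Λ ρ) {ε : ℝ} (hε : 0 < ε) (R : ℝ) :
    ∀ᶠ C : ℝ in atTop, ∀ᶠ X : ℕ in atTop,
      probN σ X (fun O => ε * (B * Real.log (X : ℝ)) ≤ |∑ P ∈ O.support.filter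
        (fun P => orbitLen P ≤ X ∧ C < |gPrime g P|), gPrime g P|) ≤
      Real.exp (R * Real.log X) := by
  obtain ⟨A, hA, hS⟩ := hB.exists_sum_le
  obtain ⟨c, K, hc, hN⟩ := exists_mul_pow_le_Ncount hσ hΛ hB hBpos
  have hΛ0 : 0 < Λ := by linarith
  set κ := Λ / (Λ - 1) with hκ
  have hκ0 : 0 < κ := div_pos hΛ0 (by linarith)
  set θ := max 0 ((1 + 2 * K + 4 * κ * A - R) / (ε * B)) with hθ
  have hθ0 : 0 ≤ θ := le_max_left _ _
  have hθR : 1 + 2 * K + 4 * κ * A - R ≤ θ * (ε * B) := by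
    rw [← div_le_iff₀ (by positivity)]
    exact le_max_right _ _
  have hlog : Tendsto (fun X : ℕ => Real.log X) atTop atTop :=
    Real.tendsto_log_atTop.comp tendsto_natCast_atTop_atTop
  filter_upwards [hρ.eventually_sum_truncWeight_le hσ hΛ θ] with C hC
  filter_upwards [hC, hlog.eventually_ge_atTop 1, hlog.eventually_ge_atTop (-Real.log c),
    eventually_ge_atTop 2] with X hX hlog1 hlogc hX2
  have hXpos : (0 : ℝ) < X := by positivity
  have hN0 : (0 : ℝ) < Ncount σ X := by exact_mod_cast Ncount_pos hσ X
  set ℓ := Real.log X with hℓ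
  have hXexp : Real.exp ℓ = X := Real.exp_log hXpos
  have hM : Mfun σ Λ X ≤ A * (2 * ℓ) :=
    (Mfun_le hσ hΛ hA.le hS X).trans (mul_le_mul_of_nonneg_left (by linarith) hA.le)
  have hcexp : 1 ≤ c * Real.exp ℓ := by
    rw [← Real.exp_log hc, ← Real.exp_add]
    exact Real.one_le_exp (by linarith)
  have hpoly : ((X : ℝ) + 1) ^ K ≤ Real.exp (2 * K * ℓ) := by
    have h1 : (X : ℝ) + 1 ≤ Real.exp (2 * ℓ) := by
      rw [two_mul, Real.exp_add, hXexp]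
      have : (2 : ℝ) ≤ X := by exact_mod_cast hX2
      nlinarith
    calc ((X : ℝ) + 1) ^ K ≤ Real.exp (2 * ℓ) ^ K := by gcongr
      _ = Real.exp (2 * K * ℓ) := by
        rw [← Real.exp_nat_mul]
        ring_nf
  have hlower : Λ ^ X ≤ Real.exp ℓ * (Ncount σ X * Real.exp (2 * K * ℓ)) := by
    calc Λ ^ X ≤ c * Real.exp ℓ * Λ ^ X := le_mul_of_one_le_left (by positivity) hcexp
      _ = Real.exp ℓ * (c * Λ ^ X) := by ring
      _ ≤ Real.exp ℓ * (Ncount σ X * ((X : ℝ) + 1) ^ K) := by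
        gcongr ?_ * ?_
        exact hN X
      _ ≤ _ := by gcongr
  rw [probN, card_genFinset_filter hσ, div_le_iff₀ hN0]
  refine (card_filter_le hσ hΛ g hθ0 C _ X).trans ?_
  calc Real.exp (-(θ * (ε * (B * ℓ)))) * (Λ ^ X * Real.exp (κ *
        ∑ P ∈ primeFinset hσ X, truncWeight g θ C P * (Λ ^ orbitLen P)⁻¹))
      ≤ Real.exp (-(θ * (ε * (B * ℓ)))) * (Real.exp ℓ * (Ncount σ X * Real.exp (2 * K * ℓ)) *
          Real.exp (κ * (2 * (A * (2 * ℓ))))) := by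
        have : ∑ P ∈ primeFinset hσ X, truncWeight g θ C P * (Λ ^ orbitLen P)⁻¹ ≤
            2 * (A * (2 * ℓ)) := hX.trans (by linarith)
        gcongr
    _ = Real.exp ((1 + 2 * K + 4 * κ * A - θ * (ε * B)) * ℓ) * Ncount σ X := by
        rw [show (1 + 2 * K + 4 * κ * A - θ * (ε * B)) * ℓ = -(θ * (ε * (B * ℓ))) +
          (ℓ + 2 * K * ℓ + κ * (2 * (A * (2 * ℓ)))) by ring, Real.exp_add, Real.exp_add,
          Real.exp_add]
        ring
    _ ≤ Real.exp (R * ℓ) * Ncount σ X := by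
        gcongr
        linarith

end Chernoff

lemma inv_mul_elog_le {p b R : ℝ} (hb : 0 < b) (hp : p ≤ Real.exp (R * b)) :
    ((b⁻¹ : ℝ) : EReal) * elog p ≤ (R : EReal) := by
  rw [elog]
  split_ifs with h
  · rw [EReal.coe_mul_bot_of_pos (inv_pos.2 hb)]
    exact bot_le
  · rw [← EReal.coe_mul, EReal.coe_le_coe_iff, inv_mul_le_iff₀ hb, mul_comm]
    rwa [← Real.log_le_iff_le_exp (not_le.1 h)] at hp

/-- Lemma (truncation of large values of `g`): for every `ε > 0`,
`limsup_{C→∞} limsup_{X→∞} (1/(B log X)) log ℙ_X[ |Σ_{P ∈ 𝒫(X), |g(P)| > C, P ∣ O} g(P)|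
≥ ε B log X ] = -∞`. -/
theorem truncation_negligible {𝒳 : Type*} (σ : 𝒳 → 𝒳) (hσ : Confined σ)
    (Λ B : ℝ) (hΛfin : GrowthEq σ Λ) (hΛ : 1 < Λ)
    (hB : CesaroLim (fun k => (fixCount σ k : ℝ) / Λ ^ k) B) (hBpos : 0 < B)
    (g : GenOrbit σ → ℝ) (hg : StronglyAdditive g)
    (ρ : Measure ℝ) (hρ : LaplaceCondition σ g Λ ρ)
    (ε : ℝ) (hε : 0 < ε) :
    Filter.limsup (fun C : ℝ =>
      Filter.limsup (fun X : ℕ =>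
        ((((B * Real.log (X : ℝ))⁻¹ : ℝ) : EReal) *
          elog (probN σ X fun O =>
            ε * (B * Real.log (X : ℝ)) ≤
              |∑ P ∈ O.support.filter
                  (fun P => orbitLen P ≤ X ∧ C < |gPrime g P|), gPrime g P|))) atTop)
      atTop = (⊥ : EReal) := by
  refine (EReal.eq_bot_iff_forall_lt _).2 fun R => ?_
  refine lt_of_le_of_lt ?_ (EReal.coe_lt_coe_iff.2 (sub_one_lt R))
  refine limsup_le_of_le (by isBoundedDefault) ?_
  filter_upwards [eventually_probN_le hσ hΛ hB hBpos hρ hε ((R - 1) * B)] with C hC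
  refine limsup_le_of_le (by isBoundedDefault) ?_
  filter_upwards [hC, eventually_ge_atTop 2] with X hX hX2
  refine inv_mul_elog_le (mul_pos hBpos (Real.log_pos (by exact_mod_cast hX2))) ?_
  rwa [← mul_assoc (R - 1)]
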